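/- The homomorphism sending the class of Y[i;j;k] (for pairwise distinct colors i, j, k) to e_i ∧ e_j ∧ e_k restricts to an isomorphism of abelian groups from A_{2,3}(n) onto the third exterior power Λ³H of H = ℤⁿ. -/

import Mathlib

/-! Common setup: the abelian group `A₂(n)` of Y-diagrams.

A generator ("Y-diagram") is modelled as a function `g : Fin 3 → Fin n × Fin 3`,
assigning to each of the three (cyclically ordered) vertices a color in `{1,…,n}`
(modelled as `Fin n`) and a label in `{1,2,3}` (modelled as `Fin 3`).
Vertices whose color is shared must carry distinct labels (otherwise the
generator is declared to be `0`); labels of vertices with a unique color are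
irrelevant, and only the relative order of labels of same-colored vertices
matters (the "relabeling" identification).  `A₂(n)` is the quotient of the free
abelian group on these generators by: the degenerate generators, the cyclic
identification, the relabeling identification, and the relations (AS), (AS2),
(W). -/

/-- A Y-diagram generator: three cyclically ordered vertices, each with a color
in `Fin n` and a label in `Fin 3`. -/
abbrev YGen (n : ℕ) := Fin 3 → Fin n × Fin 3

namespace YDiag

variable {n : ℕ}

/-- The color of the `p`-th vertex. -/
def color (g : YGen n) (p : Fin 3) : Fin n := (g p).1

/-- The label of the `p`-th vertex. -/
def lab (g : YGen n) (p : Fin 3) : Fin 3 := (g p).2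

/-- The set of defining relations for `A₂(n)` inside the free abelian group on
Y-diagram generators. -/
def rels (n : ℕ) : Set (FreeAbelianGroup (YGen n)) :=
  -- degenerate generators: two distinct vertices with the same color and label
  {x | ∃ g : YGen n, (∃ p q : Fin 3, p ≠ q ∧ g p = g q) ∧ x = FreeAbelianGroup.of g} ∪
  -- invariance under cyclic permutation of the vertices
  {x | ∃ g : YGen n, x = FreeAbelianGroup.of g - FreeAbelianGroup.of (fun p => g (p + 1))} ∪
  -- relabeling: only the relative order of labels of same-colored vertices matters
  {x | ∃ g g' : YGen n, (∀ p, color g p = color g' p) ∧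
      (∀ p q, color g p = color g q → (lab g p < lab g q ↔ lab g' p < lab g' q)) ∧
      x = FreeAbelianGroup.of g - FreeAbelianGroup.of g'} ∪
  -- (AS) : Y[i;j;k] = -Y[j;i;k] for pairwise distinct colors
  {x | ∃ g : YGen n, (color g 0 ≠ color g 1 ∧ color g 1 ≠ color g 2 ∧ color g 0 ≠ color g 2) ∧
      x = FreeAbelianGroup.of g + FreeAbelianGroup.of (g ∘ Equiv.swap 0 1)} ∪
  -- (AS2) : Y[(i,m);(i,n);x] = -Y[(i,n);(i,m);x] for distinct labels m ≠ n
  {x | ∃ g : YGen n, color g 0 = color g 1 ∧ lab g 0 ≠ lab g 1 ∧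
      x = FreeAbelianGroup.of g + FreeAbelianGroup.of (g ∘ Equiv.swap 0 1)} ∪
  -- (W) : Y[(i,m);(i,n);j] = Y[(j,m);(j,n);i] for distinct colors i ≠ j
  {x | ∃ (i j : Fin n) (m nn l l' : Fin 3), i ≠ j ∧
      x = FreeAbelianGroup.of ![(i, m), (i, nn), (j, l)] -
          FreeAbelianGroup.of ![(j, m), (j, nn), (i, l')]}

/-- The abelian group `A₂(n)`. -/
abbrev A2 (n : ℕ) :=
  FreeAbelianGroup (YGen n) ⧸ AddSubgroup.closure (rels n)

/-- The class in `A₂(n)` of a Y-diagram generator. -/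
def cls (g : YGen n) : A2 n := QuotientAddGroup.mk (FreeAbelianGroup.of g)

/-- The number of distinct colors used by the vertices of a Y-diagram. -/
def numColors (g : YGen n) : ℕ := (Finset.univ.image (color g)).card

/-- The subgroup `A_{2,k}(n)` of `A₂(n)` generated by the classes of Y-diagrams
using exactly `k` distinct colors. -/
def A2k (n k : ℕ) : AddSubgroup (A2 n) :=
  AddSubgroup.closure {x | ∃ g : YGen n, numColors g = k ∧ x = cls g}

end YDiag

namespace YDiag

variable {n : ℕ}

lemma cls_rotate (g : YGen n) : cls (fun p => g (p + 1)) = cls g := by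
  refine (QuotientAddGroup.eq_iff_sub_mem.mpr (AddSubgroup.subset_closure ?_)).symm
  simp only [rels, Set.mem_union, Set.mem_ofPred_eq]
  exact .inl <| .inl <| .inl <| .inl <| .inr ⟨g, rfl⟩

lemma cls_swap {g : YGen n} (hg : Function.Injective (color g)) :
    cls (g ∘ Equiv.swap 0 1) = -cls g := by
  refine (neg_eq_of_add_eq_zero_right ?_).symm
  refine (QuotientAddGroup.eq_zero_iff _).mpr (AddSubgroup.subset_closure ?_)
  simp only [rels, Set.mem_union, Set.mem_ofPred_eq]
  exact .inl <| .inl <| .inr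
    ⟨g, ⟨hg.ne (by decide), hg.ne (by decide), hg.ne (by decide)⟩, rfl⟩

/-- A Y-diagram with pairwise distinct colors does not depend on its labels. -/
lemma cls_eq_of_color_eq {g g' : YGen n} (hg : Function.Injective (color g))
    (h : color g = color g') : cls g = cls g' := by
  refine QuotientAddGroup.eq_iff_sub_mem.mpr (AddSubgroup.subset_closure ?_)
  simp only [rels, Set.mem_union, Set.mem_ofPred_eq]
  refine .inl <| .inl <| .inl <| .inr ⟨g, g', congrFun h, fun p q hpq => ?_, rfl⟩
  simp [hg hpq]

lemma injective_color_comp {g : YGen n} (hg : Function.Injective (color g))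
    (σ : Equiv.Perm (Fin 3)) : Function.Injective (color (g ∘ σ)) :=
  hg.comp σ.injective

lemma cls_comp_perm {g : YGen n} (hg : Function.Injective (color g))
    (σ : Equiv.Perm (Fin 3)) : cls (g ∘ σ) = Equiv.Perm.sign σ • cls g := by
  have hrot (i : ℕ) : cls (g ∘ (finRotate 3 ^ i : Equiv.Perm (Fin 3))) = cls g := by
    induction i with
    | zero => rfl
    | succ i ih =>
      rw [← ih, ← cls_rotate (g ∘ (finRotate 3 ^ i : Equiv.Perm (Fin 3)))]
      congr 1
      funext p
      simp [pow_succ]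
  obtain ⟨i, h | h⟩ : ∃ i : Fin 3, σ = finRotate 3 ^ (i : ℕ) ∨
      σ = finRotate 3 ^ (i : ℕ) * Equiv.swap 0 1 := by
    revert σ; decide
  · simp [h, hrot, sign_finRotate]
  · rw [h, Equiv.Perm.coe_mul, ← Function.comp_assoc, cls_swap (injective_color_comp hg _), hrot]
    simp [sign_finRotate]

lemma numColors_eq_three_iff {g : YGen n} :
    numColors g = 3 ↔ Function.Injective (color g) := by
  rw [← Set.injOn_univ, ← Finset.coe_univ, ← Finset.card_image_iff]
  simp [numColors]

/-- The wedge product of the basis vectors given by the colors of a Y-diagram. -/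
noncomputable def wedge (g : YGen n) : ⋀[ℤ]^3 (Fin n → ℤ) :=
  exteriorPower.ιMulti ℤ 3 fun p => Pi.single (color g p) (1 : ℤ)

lemma wedge_eq_zero {g : YGen n} {p q : Fin 3} (h : color g p = color g q) (hpq : p ≠ q) :
    wedge g = 0 :=
  AlternatingMap.map_eq_zero_of_eq _ _ (by rw [h]) hpq

lemma wedge_comp_perm (g : YGen n) (σ : Equiv.Perm (Fin 3)) :
    wedge (g ∘ σ) = Equiv.Perm.sign σ • wedge g := by
  have h := (exteriorPower.ιMulti ℤ 3).map_perm
    (fun p => Pi.single (M := fun _ : Fin n => ℤ) (color g p) (1 : ℤ)) σ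
  rcases Int.units_eq_one_or (Equiv.Perm.sign σ) with hσ | hσ <;> rw [hσ] at h ⊢
  · rw [one_smul] at h ⊢
    exact h
  · rw [Units.neg_smul, one_smul] at h ⊢
    exact h

lemma lift_wedge_eq_zero_of_mem_rels {x : FreeAbelianGroup (YGen n)} (hx : x ∈ rels n) :
    FreeAbelianGroup.lift wedge x = 0 := by
  simp only [rels, Set.mem_union, Set.mem_ofPred_eq] at hx
  rcases hx with ((((⟨g, ⟨p, q, hpq, h⟩, rfl⟩ | ⟨g, rfl⟩) | ⟨g, g', h, -, rfl⟩) |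
    ⟨g, -, rfl⟩) | ⟨g, -, -, rfl⟩) | ⟨i, j, m, m', l, l', -, rfl⟩
  · simpa using wedge_eq_zero (congrArg Prod.fst h) hpq
  · have h := wedge_comp_perm g (finRotate 3)
    have hg : g ∘ finRotate 3 = fun p => g (p + 1) := by funext p; simp
    rw [hg] at h
    simp [h, sign_finRotate]
  · simp [wedge, h]
  · simp [wedge_comp_perm]
  · simp [wedge_comp_perm]
  · simp only [map_sub, FreeAbelianGroup.lift_apply_of]
    rw [wedge_eq_zero (p := 0) (q := 1) rfl (by decide),
      wedge_eq_zero (p := 0) (q := 1) rfl (by decide), sub_zero]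

/-- The homomorphism `A₂(n) → Λ³H` sending a Y-diagram to the wedge product of its colors. -/
noncomputable def toExteriorPower (n : ℕ) : A2 n →+ ⋀[ℤ]^3 (Fin n → ℤ) :=
  QuotientAddGroup.lift _ (FreeAbelianGroup.lift wedge)
    ((AddSubgroup.closure_le _).mpr fun _ hx => lift_wedge_eq_zero_of_mem_rels hx)

lemma toExteriorPower_cls (g : YGen n) : toExteriorPower n (cls g) = wedge g := by
  simp [toExteriorPower, cls]

/-- The standard basis of `Λ³H`, indexed by the three-element sets of colors. -/
noncomputable def exteriorBasis (n : ℕ) :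
    Module.Basis (Set.powersetCard (Fin n) 3) ℤ (⋀[ℤ]^3 (Fin n → ℤ)) :=
  (Pi.basisFun ℤ (Fin n)).exteriorPower 3

/-- The Y-diagram whose colors are the elements of `s` in increasing order. -/
def sortedGen (s : Set.powersetCard (Fin n) 3) : YGen n :=
  fun p => (Set.powersetCard.ofFinEmbEquiv.symm s p, 0)

lemma injective_color_sortedGen (s : Set.powersetCard (Fin n) 3) :
    Function.Injective (color (sortedGen s)) :=
  (Set.powersetCard.ofFinEmbEquiv.symm s).injective

lemma wedge_sortedGen (s : Set.powersetCard (Fin n) 3) :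
    wedge (sortedGen s) = exteriorBasis n s := by
  rw [exteriorBasis, exteriorPower.basis_apply, exteriorPower.ιMulti_family, wedge]
  congr 1
  funext p
  simp [color, sortedGen]

/-- The homomorphism `Λ³H → A₂(n)` sending basis elements to sorted Y-diagrams. -/
noncomputable def ofExteriorPower (n : ℕ) : ⋀[ℤ]^3 (Fin n → ℤ) →ₗ[ℤ] A2 n :=
  (exteriorBasis n).constr ℤ fun s => cls (sortedGen s)

lemma ofExteriorPower_basis (s : Set.powersetCard (Fin n) 3) :
    ofExteriorPower n (exteriorBasis n s) = cls (sortedGen s) :=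
  (exteriorBasis n).constr_basis ℤ _ s

lemma exists_perm_sortedGen {g : YGen n} (hg : Function.Injective (color g)) :
    ∃ (σ : Equiv.Perm (Fin 3)) (s : Set.powersetCard (Fin n) 3),
      cls g = Equiv.Perm.sign σ • cls (sortedGen s) := by
  let τ := Tuple.sort (color g)
  have hmono : StrictMono (color g ∘ τ) :=
    (Tuple.monotone_sort _).strictMono_of_injective (hg.comp τ.injective)
  let s := Set.powersetCard.ofFinEmbEquiv (OrderEmbedding.ofStrictMono _ hmono)
  refine ⟨τ⁻¹, s, ?_⟩
  have hs : color (sortedGen s) = color (g ∘ τ) := by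
    funext p
    simp [s, color, sortedGen]
  rw [cls_eq_of_color_eq (injective_color_sortedGen s) hs,
    ← cls_comp_perm (injective_color_comp hg τ), Function.comp_assoc, ← Equiv.Perm.coe_mul,
    mul_inv_cancel, Equiv.Perm.coe_one, Function.comp_id]

lemma ofExteriorPower_toExteriorPower {x : A2 n} (hx : x ∈ A2k n 3) :
    ofExteriorPower n (toExteriorPower n x) = x := by
  induction hx using AddSubgroup.closure_induction with
  | mem x hx =>
    obtain ⟨g, hg, rfl⟩ := hx
    obtain ⟨σ, s, h⟩ := exists_perm_sortedGen (numColors_eq_three_iff.mp hg)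
    rw [h, Units.smul_def, map_zsmul, map_zsmul, toExteriorPower_cls, wedge_sortedGen,
      ofExteriorPower_basis]
  | zero => simp
  | add x y _ _ hx hy => simp [hx, hy]
  | neg x _ hx => simp [hx]

lemma exists_mem_toExteriorPower_eq (y : ⋀[ℤ]^3 (Fin n → ℤ)) :
    ∃ x ∈ A2k n 3, toExteriorPower n x = y := by
  have hy : y ∈ Submodule.span ℤ (Set.range (exteriorBasis n)) :=
    (exteriorBasis n).mem_span y
  have hle : Submodule.span ℤ (Set.range (exteriorBasis n)) ≤
      AddSubgroup.toIntSubmodule ((A2k n 3).map (toExteriorPower n)) := by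
    rw [Submodule.span_le]
    rintro _ ⟨s, rfl⟩
    refine ⟨cls (sortedGen s), AddSubgroup.subset_closure
      ⟨_, numColors_eq_three_iff.mpr (injective_color_sortedGen s), rfl⟩, ?_⟩
    rw [toExteriorPower_cls, wedge_sortedGen]
  exact hle hy

end YDiag

open YDiag in
/-- The homomorphism sending the class of `Y[i;j;k]` (pairwise distinct colors
`i`, `j`, `k`, arbitrary labels) to `e_i ∧ e_j ∧ e_k` restricts to an
isomorphism of abelian groups from `A_{2,3}(n)` onto `Λ³H`, `H = ℤⁿ`. -/
theorem A23_iso_exteriorPower (n : ℕ) (hn : 1 ≤ n) :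
    ∃ f : A2 n →+ ⋀[ℤ]^3 (Fin n → ℤ),
      (∀ (i j k : Fin n) (a b c : Fin 3), i ≠ j → j ≠ k → i ≠ k →
        (f (cls ![(i, a), (j, b), (k, c)]) : ExteriorAlgebra ℤ (Fin n → ℤ)) =
          ExteriorAlgebra.ιMulti ℤ 3
            ![Pi.single i (1 : ℤ), Pi.single j (1 : ℤ), Pi.single k (1 : ℤ)]) ∧
      Set.BijOn f (A2k n 3 : Set (A2 n)) Set.univ := by
  refine ⟨toExteriorPower n, fun i j k a b c _ _ _ => ?_, fun _ _ => Set.mem_univ _,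
    fun x hx y hy h => ?_, fun y _ => exists_mem_toExteriorPower_eq y⟩
  · rw [toExteriorPower_cls, wedge, exteriorPower.ιMulti_apply_coe]
    congr 1
    funext p
    fin_cases p <;> rfl
  · rw [← ofExteriorPower_toExteriorPower hx, h, ofExteriorPower_toExteriorPower hy]
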